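/- Under the standing hypotheses, suppose that the commutator pairing c : H × H → Lˣ (defined by c(h,h') = x y x⁻¹ y⁻¹ for any nonzero x ∈ D_h and y ∈ D_{h'} commuting with every element of D_e; this value lies in L and is independent of the choices) is nondegenerate, i.e., for every h ∈ H with h ≠ e there exists h' ∈ H with c(h,h') ≠ 1. Then the center K of D is contained in the identity component D_e. -/

import Mathlib

variable {G : Type*} [Group G] [DecidableEq G] {D : Type*} [DivisionRing D]

/-- A faithful `G`-grading on `D`: a family of additive subgroups forming an internal
direct sum decomposition, multiplicative, with all components nonzero. -/
structure IsFaithfulGrading (𝒜 : G → AddSubgroup D) : Prop where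
  one_mem : (1 : D) ∈ 𝒜 1
  mul_mem : ∀ {g h : G} {x y : D}, x ∈ 𝒜 g → y ∈ 𝒜 h → x * y ∈ 𝒜 (g * h)
  isInternal : DirectSum.IsInternal 𝒜
  faithful : ∀ g, 𝒜 g ≠ ⊥

/-- `L`, the center of the identity component `D_e`, as a set. -/
def Lset (𝒜 : G → AddSubgroup D) : Set D := {x | x ∈ 𝒜 1 ∧ ∀ y ∈ 𝒜 1, x * y = y * x}

/-- The kernel of the conjugation action of `G` on `L`, as a set:
`{g ∈ G : x·l = l·x for every x ∈ D_g and every l ∈ L}`. -/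
def Hset (𝒜 : G → AddSubgroup D) : Set G := {g | ∀ x ∈ 𝒜 g, ∀ l ∈ Lset 𝒜, x * l = l * x}


theorem aux_pow {Γ : Type*} [Group Γ] (t y l : Γ) (hl : ∀ g, l * g = g * l)
    (h : t * y = l * (y * t)) (k : ℕ) : (t * y) ^ k * l ^ (k.choose 2) = t ^ k * y ^ k := by
  have hlc : ∀ (j : ℕ) (g : Γ), l ^ j * g = g * l ^ j := fun j g => (Commute.pow_left (hl g) j)
  have h1 : ∀ k : ℕ, t ^ k * y * 1 = l ^ k * (y * t ^ k) := by
    intro k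
    induction k with
    | zero => simp
    | succ k ih =>
      rw [mul_one] at ih ⊢
      calc t ^ (k+1) * y = t * (t ^ k * y) := by rw [pow_succ']; group
        _ = t * (l ^ k * (y * t ^ k)) := by rw [ih]
        _ = l ^ k * (t * y * t ^ k) := by rw [← mul_assoc, ← hlc]; group
        _ = l ^ k * (l * (y * t) * t ^ k) := by rw [h]
        _ = l ^ (k+1) * (y * t ^ (k+1)) := by rw [pow_succ, pow_succ' t]; simp only [mul_assoc]
  induction k with
  | zero => simp
  | succ k ih =>
    have hc : (k+1).choose 2 = k.choose 2 + k := by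
      rw [Nat.choose_succ_succ' k 1, Nat.choose_one_right, add_comm]
    have h2 := h1 k
    rw [mul_one] at h2
    have h3 : t ^ k * y * t = l ^ k * (y * t * t ^ k) := by
      rw [h2]; simp only [mul_assoc]; rw [← pow_succ, ← pow_succ']
    calc (t*y)^(k+1) * l ^ ((k+1).choose 2)
        = (t*y) * ((t * y)^k * l ^ (k.choose 2)) * l ^ k := by
          rw [hc, pow_succ' (t * y), pow_add l]; simp only [mul_assoc]
      _ = (t * y) * (t ^ k * y ^ k) * l ^ k := by rw [ih]
      _ = t * (l ^ k * (y * t ^ k)) * y ^ k := by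
          rw [mul_assoc (t * y), mul_assoc (t ^ k), ← hlc k (y ^ k)]
          have h4 := hlc k (y * t ^ k)
          calc t * y * (t ^ k * (l ^ k * y ^ k)) = t * (y * t ^ k * l ^ k) * y ^ k := by
                simp only [mul_assoc]
            _ = _ := by rw [← h4]
      _ = t ^ (k+1) * y ^ (k+1) := by
          rw [← h2, pow_succ', pow_succ']; simp only [mul_assoc]

structure Cfg {Γ H : Type*} [Group Γ] [Group H] (δ : Γ →* H) (n : ℕ) (ε : Γ) : Prop where
  hc : ∀ z, δ z = 1 → ∀ g, z * g = g * z
  hn : ∀ h : H, h ^ n = 1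
  n0 : n ≠ 0
  root : ∀ g : Γ, g ^ n = 1 → δ g = 1
  e1 : δ ε = 1
  ene : ε ≠ 1
  e2 : ε ^ 2 = 1
  sq : ∀ g : Γ, g ^ 2 = 1 → g = 1 ∨ g = ε
  q8 : 3 ∣ n → ∀ i j : Γ, i ^ 2 = ε → j ^ 2 = ε → i * j = ε * (j * i) → δ i ≠ 1 → δ j ≠ 1 →
    δ i ≠ δ j → False
  surj : Function.Surjective δ

section
variable {Γ H : Type*} [Group Γ] [Group H] {δ : Γ →* H} {n : ℕ} {ε : Γ}

theorem Cfg.B (C : Cfg δ n ε) (x y : Γ)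
    (hcomm : δ (x * y * x⁻¹) * δ y = δ y * δ (x * y * x⁻¹)) :
    δ x * δ y = δ y * δ x ∨
    ((x * y * x⁻¹) * y = ε * (y * (x * y * x⁻¹)) ∧ Even (orderOf (δ y)) ∧ ¬ 4 ∣ n) := by
  set y1 := x * y * x⁻¹ with hy1
  set m := orderOf (δ y) with hm
  set t := y1 * y⁻¹ with ht
  set l := y1 * y * y1⁻¹ * y⁻¹ with hl
  have hmn : m ∣ n := orderOf_dvd_of_pow_eq_one (C.hn _)
  have hm0 : m ≠ 0 := fun h => C.n0 (by simpa [h] using hmn)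
  have hlz : δ l = 1 := by
    rw [hl, map_mul, map_mul, map_mul, map_inv, map_inv, hcomm]; group
  have hlc := C.hc l hlz
  have hym : δ (y ^ m) = 1 := by rw [map_pow, hm, pow_orderOf_eq_one]
  have hymc := C.hc _ hym
  have hy1m : y1 ^ m = y ^ m := by
    rw [hy1, conj_pow, ← hymc]; group
  have htx : δ t = 1 → δ x * δ y = δ y * δ x := by
    intro h
    have : δ (x * y * x⁻¹ * y⁻¹) = 1 := h
    simp only [map_mul, map_inv] at this
    rw [mul_inv_eq_one, mul_inv_eq_iff_eq_mul] at this
    exact this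
  have hty : t * y = y1 := by rw [ht]; group
  have htyl : t * y = l * (y * t) := by rw [hty, hl, ht]; group
  have hlm : l ^ m = 1 := by
    have h1 : y1 * y * y1⁻¹ = l * y := by rw [hl]; group
    have h2 : (y1 * y * y1⁻¹) ^ m = y ^ m := by rw [conj_pow, ← hymc]; group
    rw [h1, Commute.mul_pow (hlc y)] at h2
    simpa using h2
  have hroot : ∀ g : Γ, g ^ m = 1 → δ g = 1 := fun g hg => C.root g (by
    obtain ⟨k, hk⟩ := hmn; rw [hk, pow_mul, hg, one_pow])
  have htm : t ^ m = l ^ (m.choose 2) := by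
    have := aux_pow t y l hlc htyl m
    rw [hty, hy1m, hymc] at this
    exact (mul_right_cancel this).symm
  have hch : m.choose 2 * 2 = m * (m - 1) := by
    rw [Nat.choose_two_right, Nat.div_mul_cancel (Nat.even_mul_pred_self m).two_dvd]
  have ht2m : t ^ (2 * m) = 1 := by
    rw [mul_comm, pow_mul, htm, ← pow_mul, hch, pow_mul, hlm, one_pow]
  have ht2 : δ (t ^ 2) = 1 := hroot _ (by rw [← pow_mul, ht2m])
  have hl2 : l ^ 2 = 1 := by
    have h1 := C.hc _ ht2 y
    have h2 : t ^ 2 * y = l ^ 2 * (y * t ^ 2) := by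
      calc t ^ 2 * y = t * (t * y) := by rw [pow_two]; group
        _ = t * (l * (y * t)) := by rw [htyl]
        _ = l * (t * y) * t := by rw [← mul_assoc, ← hlc]; group
        _ = l * (l * (y * t)) * t := by rw [htyl]
        _ = _ := by rw [pow_two, pow_two]; group
    rw [h1] at h2
    simpa using h2.symm
  rcases C.sq l hl2 with h1 | h1
  · left; apply htx; apply hroot; rw [htm, h1, one_pow]
  by_cases hev : Even m
  · by_cases h4 : 4 ∣ n
    · left; apply htx
      by_cases hm4 : 4 ∣ m
      · apply hroot
        obtain ⟨k, hk⟩ := hm4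
        have : m.choose 2 = 2 * (k * (m - 1)) := by
          have : m * (m-1) = 2 * (2 * (k * (m-1))) := by
            generalize m - 1 = j
            rw [hk]; ring
          omega
        rw [htm, this, pow_mul, hl2, one_pow]
      · apply C.root
        have : 2 * m ∣ n := by
          obtain ⟨k, hk⟩ := hev
          obtain ⟨a, ha⟩ := hmn
          obtain ⟨b, hb⟩ := h4
          have hk2 : ¬ 2 ∣ k := by omega
          have : 2 ∣ k * a := ⟨b, by
            have : 2 * (k * a) = 4 * b := by rw [← hb, ha, hk]; ring
            omega⟩
          rcases (Nat.Prime.dvd_mul Nat.prime_two).1 this with h | h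
          · exact absurd h hk2
          · rw [ha, mul_comm]; exact mul_dvd_mul_left _ h
        obtain ⟨k, hk⟩ := this
        rw [hk, pow_mul, ht2m, one_pow]
    · right; refine ⟨?_, hev, h4⟩
      rw [← h1, hl]; group
  · left; apply htx; apply hroot
    rw [Nat.not_even_iff_odd] at hev
    obtain ⟨k, hk⟩ := hev
    have : l = 1 := by
      have := hlm
      rw [hk, pow_succ, pow_mul, hl2] at this
      simpa using this
    rw [htm, this, one_pow]

theorem even_prime {p k m : ℕ} (hp : p.Prime) (hm : m = p ^ k) (he : Even m) : p = 2 := by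
  subst hm
  exact ((Nat.prime_dvd_prime_iff_eq Nat.prime_two hp).1
    (Nat.prime_two.dvd_of_dvd_pow he.two_dvd)).symm

theorem Cfg.sq_one (C : Cfg δ n ε) (h4 : ¬ 4 ∣ n) (P : Subgroup H) (hP : IsPGroup 2 P)
    (a : H) (ha : a ∈ P) : a ^ 2 = 1 := by
  obtain ⟨k, hk⟩ := hP ⟨a, ha⟩
  have hk : a ^ (2 ^ k) = 1 := by simpa [Subtype.ext_iff] using hk
  obtain ⟨j, -, hj⟩ := (Nat.dvd_prime_pow Nat.prime_two).1 (orderOf_dvd_of_pow_eq_one hk)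
  have hn : orderOf a ∣ n := orderOf_dvd_of_pow_eq_one (C.hn a)
  have : j ≤ 1 := by
    by_contra hlt
    apply h4
    rw [hj] at hn
    exact (pow_dvd_pow 2 (show 2 ≤ j by omega)).trans hn
  apply orderOf_dvd_iff_pow_eq_one.1
  rw [hj]
  exact pow_dvd_pow 2 this

theorem Cfg.pabel (C : Cfg δ n ε) [Finite H] (p : ℕ) [hp : Fact p.Prime] (P : Subgroup H)
    (hP : IsPGroup p P) : ∀ a ∈ P, ∀ b ∈ P, a * b = b * a := by
  by_contra hcon
  have hne : Subgroup.center P ≠ ⊤ := by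
    intro h
    apply hcon
    intro a ha b hb
    have : (⟨b, hb⟩ : P) ∈ Subgroup.center P := by rw [h]; trivial
    have := Subgroup.mem_center_iff.1 this ⟨a, ha⟩
    simpa [Subtype.ext_iff] using this
  have hnt : Nontrivial (P ⧸ Subgroup.center P) := by
    rw [QuotientGroup.nontrivial_iff]; exact hne
  have := (hP.to_quotient (Subgroup.center P)).center_nontrivial
  obtain ⟨⟨q, hq⟩, hq1⟩ := exists_ne (1 : Subgroup.center (P ⧸ Subgroup.center P))
  obtain ⟨a, rfl⟩ := QuotientGroup.mk_surjective q
  have ha : a ∉ Subgroup.center P := by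
    intro h; apply hq1; apply Subtype.ext
    exact (QuotientGroup.eq_one_iff a).2 h
  rw [Subgroup.mem_center_iff] at ha
  push Not at ha
  obtain ⟨b, hb⟩ := ha
  have hcen : b * a * b⁻¹ * a⁻¹ ∈ Subgroup.center P := by
    rw [← QuotientGroup.eq_one_iff]
    have := Subgroup.mem_center_iff.1 hq (b : P ⧸ Subgroup.center P)
    rw [QuotientGroup.mk_mul, QuotientGroup.mk_mul, QuotientGroup.mk_mul, QuotientGroup.mk_inv,
      QuotientGroup.mk_inv, this]
    group
  have hcc : (b * a * b⁻¹) * a = a * (b * a * b⁻¹) := by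
    have := Subgroup.mem_center_iff.1 hcen a
    calc (b * a * b⁻¹) * a = (b * a * b⁻¹ * a⁻¹) * a * a := by group
      _ = a * (b * a * b⁻¹ * a⁻¹) * a := by rw [this]
      _ = _ := by group
  obtain ⟨x, hx⟩ := C.surj b
  obtain ⟨y, hy⟩ := C.surj a
  have h := C.B x y (by
    simp only [map_mul, map_inv, hx, hy]; exact_mod_cast congrArg Subtype.val hcc)
  rw [hx, hy] at h
  rcases h with h | ⟨-, hev, h4⟩
  · exact hb (Subtype.ext h)
  · obtain ⟨k, hk⟩ := (IsPGroup.iff_orderOf.1 hP) a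
    rw [Subgroup.orderOf_coe] at hev
    obtain rfl := even_prime hp.out hk hev
    apply hcon
    intro a ha b hb
    have h1 := C.sq_one h4 P hP a ha
    have h2 := C.sq_one h4 P hP b hb
    have h3 := C.sq_one h4 P hP (a * b) (P.mul_mem ha hb)
    rw [pow_two] at h1 h2 h3
    have e1 : a = a⁻¹ := eq_inv_of_mul_eq_one_left h1
    have e2 : b = b⁻¹ := eq_inv_of_mul_eq_one_left h2
    have e3 := eq_inv_of_mul_eq_one_left h3
    rw [mul_inv_rev, ← e1, ← e2] at e3
    exact e3

/-- key dichotomy for p = 2 -/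
theorem Cfg.dich (C : Cfg δ n ε) (P : Subgroup H)
    (hab : ∀ a ∈ P, ∀ b ∈ P, a * b = b * a) (x y : Γ) (hy : δ y ∈ P)
    (hx : δ x * δ y * (δ x)⁻¹ ∈ P) (hne : δ x * δ y ≠ δ y * δ x) :
    (x * y * x⁻¹) * y = ε * (y * (x * y * x⁻¹)) := by
  rcases C.B x y (by
    simp only [map_mul, map_inv]; exact hab _ hx _ hy) with h | h
  · exact absurd h hne
  · exact h.1

theorem comm_of_pow {h z : H} {a b : ℕ} (hab : Nat.Coprime a b) (ha : h ^ a * z = z * h ^ a)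
    (hb : h ^ b * z = z * h ^ b) : h * z = z * h := by
  have key : ∀ k, h ^ k ∈ Subgroup.centralizer {z} ↔ h ^ k * z = z * h ^ k := by
    intro k; rw [Subgroup.mem_centralizer_singleton_iff]; 
  have h1 := (Subgroup.centralizer {z}).zpow_mem ((key a).2 ha) (Nat.gcdA a b)
  have h2 := (Subgroup.centralizer {z}).zpow_mem ((key b).2 hb) (Nat.gcdB a b)
  have h3 := (Subgroup.centralizer {z}).mul_mem h1 h2
  rw [← zpow_natCast, ← zpow_natCast, ← zpow_mul, ← zpow_mul, ← zpow_add,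
    ← Nat.gcd_eq_gcd_ab, hab] at h3
  simpa using (key 1).1 (by simpa using h3)

theorem anti_conj (C : Cfg δ n ε) (x a b : Γ) (h : a * b = ε * (b * a)) :
    (x * a * x⁻¹) * (x * b * x⁻¹) = ε * ((x * b * x⁻¹) * (x * a * x⁻¹)) := by
  have he := C.hc ε C.e1 x
  calc (x * a * x⁻¹) * (x * b * x⁻¹) = x * (a * b) * x⁻¹ := by group
    _ = x * ε * (b * a) * x⁻¹ := by rw [h]; group
    _ = _ := by rw [← he]; group

theorem anti_symm (C : Cfg δ n ε) {a b : Γ} (h : a * b = ε * (b * a)) :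
    b * a = ε * (a * b) := by
  rw [h, ← mul_assoc, ← pow_two, C.e2, one_mul]

/-- a anticommutes with both b and c implies commutes with the product -/
theorem anti_anti (C : Cfg δ n ε) {a b c : Γ} (h : a * b = ε * (b * a)) (h' : a * c = ε * (c * a)) :
    a * (b * c) = (b * c) * a := by
  have he := C.hc ε C.e1 
  calc a * (b * c) = a * b * c := by group
    _ = ε * b * (a * c) := by rw [h]; group
    _ = ε * (b * ε) * (c * a) := by rw [h']; group
    _ = ε ^ 2 * (b * c) * a := by rw [← he b, pow_two]; group
    _ = _ := by rw [C.e2, one_mul]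


theorem Cfg.norm (C : Cfg δ n ε) [Finite H] (p : ℕ) [hp : Fact p.Prime] (P : Sylow p H) :
    Subgroup.normalizer (P : Set H) ≤ Subgroup.centralizer (P : Set H) := by
  intro h hh z hz
  by_contra hne
  have hne : h * z ≠ z * h := fun h => hne h.symm
  have hab := C.pabel p (P : Subgroup H) P.2
  have hconj : ∀ w ∈ (P : Subgroup H), h * w * h⁻¹ ∈ (P : Subgroup H) := fun w hw =>
    (Subgroup.mem_normalizer_iff.1 hh w).1 hw
  have hconj2 : ∀ w ∈ (P : Subgroup H), h ^ 2 * w * (h ^ 2)⁻¹ ∈ (P : Subgroup H) := fun w hw =>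
    (Subgroup.mem_normalizer_iff.1 (Subgroup.pow_mem _ hh 2) w).1 hw
  have hconj3 : ∀ w ∈ (P : Subgroup H), h ^ 3 * w * (h ^ 3)⁻¹ ∈ (P : Subgroup H) := fun w hw =>
    (Subgroup.mem_normalizer_iff.1 (Subgroup.pow_mem _ hh 3) w).1 hw
  have hz : z ∈ (P : Subgroup H) := hz
  obtain ⟨x, hx⟩ := C.surj h
  obtain ⟨y, hy⟩ := C.surj z
  have hB := C.B x y (by
    simp only [map_mul, map_inv, hx, hy]
    exact hab _ (hconj z hz) _ hz)
  rw [hx, hy] at hB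
  rcases hB with hB | ⟨a01, hev, h4⟩
  · exact hne hB
  obtain ⟨k, hk⟩ := (IsPGroup.iff_orderOf.1 P.2) ⟨z, hz⟩
  have hk' : orderOf z = p ^ k := by rw [← hk, ← Subgroup.orderOf_coe]
  obtain rfl := even_prime hp.out hk' hev
  have h2n : 2 ∣ n := hev.two_dvd.trans (orderOf_dvd_of_pow_eq_one (C.hn z))
  obtain ⟨r, hr⟩ := h2n
  have hrodd : Odd r := by
    rw [← Nat.not_even_iff_odd]
    rintro ⟨s, rfl⟩
    exact h4 ⟨s, by omega⟩
  have hsq := C.sq_one h4 (P : Subgroup H) P.2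
  have hrP : h ^ r ∈ (P : Subgroup H) := by
    have hpg : IsPGroup 2 (Subgroup.zpowers (h ^ r)) := by
      rintro ⟨g, hg⟩
      refine ⟨1, ?_⟩
      obtain ⟨j, rfl⟩ := Subgroup.mem_zpowers_iff.1 hg
      apply Subtype.ext
      have : (h ^ r) ^ 2 = 1 := by rw [← pow_mul, mul_comm, ← hr, C.hn]
      simp only [pow_one, SubmonoidClass.mk_pow, OneMemClass.coe_one]
      rw [← zpow_natCast, ← zpow_mul, mul_comm, zpow_mul, zpow_natCast, this, one_zpow]
    have := hpg.inf_normalizer_sylow P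
    have hm : h ^ r ∈ Subgroup.zpowers (h ^ r) ⊓ Subgroup.normalizer (P : Set H) :=
      ⟨Subgroup.mem_zpowers _, Subgroup.pow_mem _ hh r⟩
    rw [this] at hm
    exact hm.2
  have hrc : h ^ r * z = z * h ^ r := hab _ hrP _ hz
  have hne4 : h ^ 4 * z ≠ z * h ^ 4 := fun hc => hne (comm_of_pow (a := 4) (b := r)
    (by
      have : Nat.Coprime (2 ^ 2) r := Nat.Coprime.pow_left 2 (Nat.coprime_two_left.2 hrodd)
      simpa using this) hc hrc)
  have hne2 : h ^ 2 * z ≠ z * h ^ 2 := fun hc => hne (comm_of_pow (a := 2) (b := r)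
    (Nat.coprime_two_left.2 hrodd) hc hrc)
  set y1 := x * y * x⁻¹ with hy1
  set y2 := x * y1 * x⁻¹ with hy2
  set y3 := x * y2 * x⁻¹ with hy3
  have e2 : y2 = x ^ 2 * y * (x ^ 2)⁻¹ := by rw [hy2, hy1, pow_two]; group
  have e3 : y3 = x ^ 3 * y * (x ^ 3)⁻¹ := by
    rw [hy3, e2, pow_succ' x 2, mul_inv_rev]; simp only [mul_assoc]
  have d1 : δ y1 = h * z * h⁻¹ := by rw [hy1]; simp only [map_mul, map_inv, hx, hy]
  have d2 : δ y2 = h ^ 2 * z * (h ^ 2)⁻¹ := by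
    rw [e2]; simp only [map_mul, map_inv, map_pow, hx, hy]
  have a02 : y2 * y = ε * (y * y2) := by
    rw [e2]
    exact C.dich P hab (x ^ 2) y (by rw [hy]; exact hz)
      (by rw [map_pow, hx, hy]; exact hconj2 z hz) (by rw [map_pow, hx, hy]; exact hne2)
  have a12 : y2 * y1 = ε * (y1 * y2) := anti_conj C x _ _ a01
  by_cases h3 : h ^ 3 * z = z * h ^ 3
  · have h3n : 3 ∣ n := by
      by_contra h3n
      exact hne (comm_of_pow (a := 3) (b := n) ((Nat.Prime.coprime_iff_not_dvd Nat.prime_three).2 h3n)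
        h3 (by rw [C.hn]; simp))
    have hyz : δ (y ^ 2) = 1 := by rw [map_pow, hy, hsq z hz]
    have hy1s : y1 ^ 2 = y ^ 2 := by
      rw [hy1, conj_pow, ← C.hc _ hyz]; group
    set i := y1 * y⁻¹ with hi
    have hi2 : i ^ 2 = ε := by
      have e : y⁻¹ * y1 = ε * (y1 * y⁻¹) := by
        calc y⁻¹ * y1 = y⁻¹ * (y1 * y) * y⁻¹ := by group
          _ = y⁻¹ * ε * (y * y1) * y⁻¹ := by rw [a01]; group
          _ = _ := by rw [← C.hc ε C.e1]; group
      calc i ^ 2 = y1 * (y⁻¹ * y1) * y⁻¹ := by rw [hi, pow_two]; group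
        _ = (y1 * ε) * (y1 * y⁻¹) * y⁻¹ := by rw [e]; group
        _ = ε * y1 ^ 2 * (y ^ 2)⁻¹ := by rw [← C.hc ε C.e1, pow_two, pow_two]; group
        _ = ε := by rw [hy1s]; group
    have di : δ i = h * z * h⁻¹ * z⁻¹ := by rw [hi, map_mul, map_inv, d1, hy]
    have hiP : δ i ∈ (P : Subgroup H) := by
      rw [di]; exact mul_mem (hconj z hz) (inv_mem hz)
    have hi1 : δ i ≠ 1 := by
      rw [di]; intro hc
      rw [mul_inv_eq_one, mul_inv_eq_iff_eq_mul] at hc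
      exact hne hc
    set j := x * i * x⁻¹ with hj
    have hj2 : j ^ 2 = ε := by
      rw [hj, conj_pow, hi2, ← C.hc ε C.e1]; group
    have dj : δ j = h * δ i * h⁻¹ := by rw [hj]; simp only [map_mul, map_inv, hx]
    have hj1 : δ j ≠ 1 := by
      rw [dj]; intro hc; exact hi1 (conj_eq_one_iff.1 hc)
    have hij : δ i ≠ δ j := by
      have dj' : δ j = δ y2 * (δ y1)⁻¹ := by
        rw [← map_inv, ← map_mul, hj, hi, hy2]; congr 1; rw [hy1]; group
      have p1 : δ y1 ∈ (P : Subgroup H) := by rw [d1]; exact hconj z hz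
      have p2 : δ y2 ∈ (P : Subgroup H) := by rw [d2]; exact hconj2 z hz
      rw [dj', hi, map_mul, map_inv, hy]
      intro hc
      have s1 := hsq _ p1
      have sz := hsq _ hz
      have s1' : (δ y1)⁻¹ = δ y1 := inv_eq_of_mul_eq_one_left (by rw [← pow_two]; exact s1)
      have sz' : z⁻¹ = z := inv_eq_of_mul_eq_one_left (by rw [← pow_two]; exact sz)
      rw [s1', sz', hab _ p2 _ p1] at hc
      have hc := mul_left_cancel hc
      rw [d2, eq_mul_inv_iff_mul_eq] at hc
      exact hne2 hc.symm
    have hji : j * i = ε * (i * j) := C.dich P hab x i hiP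
      (by rw [hx]; exact hconj _ hiP)
      (by
        rw [hx]; intro hc; apply hij; rw [dj, hc]; group)
    exact C.q8 h3n i j hi2 hj2 (anti_symm C hji) hi1 hj1 hij
  · have a03 : y3 * y = ε * (y * y3) := by
      rw [e3]
      exact C.dich P hab (x ^ 3) y (by rw [hy]; exact hz)
        (by rw [map_pow, hx, hy]; exact hconj3 z hz) (by rw [map_pow, hx, hy]; exact h3)
    have a13 : y3 * y1 = ε * (y1 * y3) := anti_conj C x _ _ a02
    have a23 : y3 * y2 = ε * (y2 * y3) := anti_conj C x _ _ a12
    have c0 : y * (y1 * y3) = y1 * y3 * y := anti_anti C (anti_symm C a01) (anti_symm C a03)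
    have c2 : y2 * (y1 * y3) = y1 * y3 * y2 := anti_anti C a12 (anti_symm C a23)
    have c3 : (y1 * y3) * (y * y2) = (y * y2) * (y1 * y3) := by
      rw [← mul_assoc, ← c0, mul_assoc, ← c2, ← mul_assoc]
    have ew : x * (y * y2) * x⁻¹ = y1 * y3 := by rw [hy3, hy1]; group
    have dw : δ (y * y2) = z * (h ^ 2 * z * (h ^ 2)⁻¹) := by rw [map_mul, hy, d2]
    have hwP : δ (y * y2) ∈ (P : Subgroup H) := by
      rw [dw]; exact mul_mem hz (hconj2 z hz)
    have hwc : h * δ (y * y2) = δ (y * y2) * h := by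
      by_contra hcon
      have := C.dich P hab x (y * y2) hwP (by rw [hx]; exact hconj _ hwP) (by rw [hx]; exact hcon)
      rw [ew, c3] at this
      exact C.ene (by simpa using this.symm)
    have hwc2 : h ^ 2 * δ (y * y2) = δ (y * y2) * h ^ 2 := Commute.pow_left hwc 2
    rw [dw] at hwc2
    have h5 := hab _ hz _ (hconj2 z hz)
    apply hne4
    rw [h5] at hwc2
    have h6 : h ^ 2 * (h ^ 2 * z * (h ^ 2)⁻¹ * z) * (h ^ 2)⁻¹ = h ^ 2 * z * (h ^ 2)⁻¹ * z := by
      rw [hwc2]; group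
    rw [← h5] at h6
    have h7 : (h ^ 2 * z * (h ^ 2)⁻¹) * (h ^ 4 * z * (h ^ 4)⁻¹) = (h ^ 2 * z * (h ^ 2)⁻¹) * z := by
      rw [← h5, ← h6]; group
    have h8 := mul_left_cancel h7
    exact mul_inv_eq_iff_eq_mul.1 h8

theorem Cfg.abel (C : Cfg δ n ε) [Finite H] (a b : H) : a * b = b * a := by
  have key : ∀ g : H, (∀ p : ℕ, ∀ hp : Fact p.Prime, ∀ P : Sylow p H,
      g ∈ (MonoidHom.transferSylow P (C.norm p P)).ker) → g = 1 := by
    intro g hg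
    by_contra hne
    obtain ⟨p, hp, hpd⟩ := Nat.exists_prime_and_dvd (fun h => hne (orderOf_eq_one_iff.1 h))
    have : Fact p.Prime := ⟨hp⟩
    obtain ⟨P⟩ : Nonempty (Sylow p H) := inferInstance
    apply MonoidHom.not_dvd_card_ker_transferSylow P (C.norm p P)
    have := hg p ⟨hp⟩ P
    refine hpd.trans ?_
    have h2 := orderOf_dvd_natCard (⟨g, this⟩ : (MonoidHom.transferSylow P (C.norm p P)).ker)
    rwa [← Subgroup.orderOf_coe] at h2
  have := key (a * b * a⁻¹ * b⁻¹) (by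
    intro p hp P
    rw [MonoidHom.mem_ker]
    have hc : ∀ u v : P, u * v = v * u := fun u v =>
      Subtype.ext (C.pabel p (P : Subgroup H) P.2 u u.2 v v.2)
    simp only [map_mul, map_inv]
    rw [hc (MonoidHom.transferSylow P (C.norm p P) a)]
    group)
  rw [mul_inv_eq_one, mul_inv_eq_iff_eq_mul] at this
  exact this
end

theorem sq_one_cases (x : D) (h : x ^ 2 = 1) : x = 1 ∨ x = -1 := by
  have h0 : (x - 1) * (x + 1) = 0 := by
    have : (x - 1) * (x + 1) = x ^ 2 - 1 := by noncomm_ring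
    rw [this, h, sub_self]
  rcases mul_eq_zero.1 h0 with h | h
  · left; exact sub_eq_zero.1 h
  · right; exact eq_neg_of_add_eq_zero_left h

theorem q8_elt (i j w : D) (hi : i ^ 2 = -1) (hj : j ^ 2 = -1) (hij : i * j = -(j * i))
    (hw : ∀ a, w * a = a * w) (hww : w ^ 2 + w + 1 = 0) :
    1 + i + j + i * j = -(w + w) ∨ 1 + i + j + i * j = -(w ^ 2 + w ^ 2) := by
  set U := 1 + i + j + i * j with hU
  have hji : j * i = -(i * j) := by rw [hij, neg_neg]
  rw [pow_two] at hi hj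
  have t1 : i * (i * j) = -j := by rw [← mul_assoc, hi]; simp
  have t2 : j * (i * j) = i := by rw [hij, mul_neg, ← mul_assoc, hj]; simp
  have t3 : i * j * i = j := by rw [mul_assoc, hji, mul_neg, t1, neg_neg]
  have t4 : i * j * j = -i := by rw [mul_assoc, hj]; simp
  have t5 : i * j * (i * j) = -1 := by rw [mul_assoc, t2, hi]
  have hUU : U * U = U + U - 4 := by
    rw [hU]
    simp only [mul_add, add_mul, mul_one, one_mul, t1, t2, t3, t4, t5, hi, hj, hji]
    have : (4 : D) = 1 + 1 + 1 + 1 := by norm_num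
    rw [this]
    abel
  have hw2 : w ^ 2 = -1 - w := by
    rw [eq_sub_iff_add_eq, eq_neg_iff_add_eq_zero]; exact hww
  have hw2' : w * w = -1 - w := by rw [← pow_two, hw2]
  have : (U + (w + w)) * (U + (w ^ 2 + w ^ 2)) = 0 := by
    rw [hw2]
    simp only [mul_add, add_mul, mul_sub, sub_mul, mul_neg, neg_mul, mul_one, one_mul, hUU, hw2',
      hw U]
    have : (4 : D) = 1 + 1 + 1 + 1 := by norm_num
    rw [this]
    abel
  rcases mul_eq_zero.1 this with h | h
  · left; exact eq_neg_of_add_eq_zero_left h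
  · right; exact eq_neg_of_add_eq_zero_left h

theorem exists_proj (𝒜 : G → AddSubgroup D) (hG : IsFaithfulGrading 𝒜) [Fintype G] :
    ∃ π : G → D →+ D, (∀ g x, π g x ∈ 𝒜 g) ∧ (∀ x, ∑ g, π g x = x) ∧
      (∀ g x, x ∈ 𝒜 g → π g x = x) ∧ (∀ g h x, x ∈ 𝒜 g → g ≠ h → π h x = 0) := by
  classical
  letI := hG.isInternal.chooseDecomposition
  refine ⟨fun g => AddMonoidHom.mk' (fun x => (DirectSum.decompose 𝒜 x g : D)) ?_, ?_, ?_, ?_, ?_⟩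
  · intro a b; simp [DirectSum.decompose_add]
  · intro g x; exact (DirectSum.decompose 𝒜 x g).2
  · intro x
    conv_rhs => rw [← DirectSum.sum_support_decompose 𝒜 x]
    symm
    apply Finset.sum_subset (Finset.subset_univ _)
    intro g _ hg
    simpa using hg
  · intro g x hx; exact DirectSum.decompose_of_mem_same 𝒜 hx
  · intro g h x hx hne; exact DirectSum.decompose_of_mem_ne 𝒜 hx hne

theorem proj_mul_left [Fintype G] {𝒜 : G → AddSubgroup D} (hG : IsFaithfulGrading 𝒜) {π : G → D →+ D}
    (h1 : ∀ g x, π g x ∈ 𝒜 g) (h2 : ∀ x, ∑ g, π g x = x)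
    (h3 : ∀ g x, x ∈ 𝒜 g → π g x = x) (h4 : ∀ g h x, x ∈ 𝒜 g → g ≠ h → π h x = 0)
    (y x : D) (h g : G) (hy : y ∈ 𝒜 h) : π (h * g) (y * x) = y * π g x := by
  conv_lhs => rw [← h2 x, Finset.mul_sum, map_sum]
  rw [Finset.sum_eq_single g]
  · exact h3 _ _ (hG.mul_mem hy (h1 _ _))
  · intro k _ hk
    exact h4 _ _ _ (hG.mul_mem hy (h1 _ _)) (fun h => hk (mul_left_cancel h))
  · simp

theorem proj_mul_right [Fintype G] {𝒜 : G → AddSubgroup D} (hG : IsFaithfulGrading 𝒜) {π : G → D →+ D}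
    (h1 : ∀ g x, π g x ∈ 𝒜 g) (h2 : ∀ x, ∑ g, π g x = x)
    (h3 : ∀ g x, x ∈ 𝒜 g → π g x = x) (h4 : ∀ g h x, x ∈ 𝒜 g → g ≠ h → π h x = 0)
    (y x : D) (h g : G) (hy : y ∈ 𝒜 h) : π (g * h) (x * y) = π g x * y := by
  conv_lhs => rw [← h2 x, Finset.sum_mul, map_sum]
  rw [Finset.sum_eq_single g]
  · exact h3 _ _ (hG.mul_mem (h1 _ _) hy)
  · intro k _ hk
    exact h4 _ _ _ (hG.mul_mem (h1 _ _) hy) (fun h => hk (mul_right_cancel h))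
  · simp

theorem inv_hom [Fintype G] {𝒜 : G → AddSubgroup D} (hG : IsFaithfulGrading 𝒜) {π : G → D →+ D}
    (h1 : ∀ g x, π g x ∈ 𝒜 g) (h2 : ∀ x, ∑ g, π g x = x)
    (h3 : ∀ g x, x ∈ 𝒜 g → π g x = x) (h4 : ∀ g h x, x ∈ 𝒜 g → g ≠ h → π h x = 0)
    (x : D) (hx : x ≠ 0) (g : G) (hg : x ∈ 𝒜 g) : x⁻¹ ∈ 𝒜 g⁻¹ := by
  have := proj_mul_left hG h1 h2 h3 h4 x x⁻¹ g g⁻¹ hg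
  rw [mul_inv_cancel₀ hx, mul_inv_cancel, h3 1 1 hG.one_mem] at this
  rw [← eq_inv_of_mul_eq_one_right this.symm]
  exact h1 _ _
theorem eq_deg {𝒜 : G → AddSubgroup D} [Fintype G] {π : G → D →+ D}
  (h3 : ∀ g x, x ∈ 𝒜 g → π g x = x) (h4 : ∀ g h x, x ∈ 𝒜 g → g ≠ h → π h x = 0)
  {x : D} (hx : x ≠ 0) {g h : G} (hg : x ∈ 𝒜 g) (hh : x ∈ 𝒜 h) : g = h := by
  by_contra hne
  exact hx (by rw [← h3 h x hh, h4 g h x hg hne])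

/-- homogeneous units centralizing the identity component, with their degrees -/
def GammaGrp (𝒜 : G → AddSubgroup D) (hone : (1 : D) ∈ 𝒜 1)
    (hmul : ∀ {g h : G} {x y : D}, x ∈ 𝒜 g → y ∈ 𝒜 h → x * y ∈ 𝒜 (g * h))
    (hinv : ∀ (x : D), x ≠ 0 → ∀ g : G, x ∈ 𝒜 g → x⁻¹ ∈ 𝒜 g⁻¹)
    (H : Subgroup G) : Subgroup (Dˣ × H) where
  carrier := {u | (u.1 : D) ∈ 𝒜 u.2 ∧ ∀ a ∈ 𝒜 1, (u.1 : D) * a = a * u.1}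
  one_mem' := ⟨by simpa using hone, by simp⟩
  mul_mem' := by
    rintro ⟨u, g⟩ ⟨v, h⟩ ⟨h1, h2⟩ ⟨h3, h4⟩
    refine ⟨by simpa using hmul h1 h3, ?_⟩
    intro a ha
    simp only at h2 h4
    simp only [Prod.mk_mul_mk, Units.val_mul]
    rw [mul_assoc, h4 a ha, ← mul_assoc, h2 a ha, mul_assoc]
  inv_mem' := by
    rintro ⟨u, g⟩ ⟨h1, h2⟩
    refine ⟨by simpa using hinv _ u.ne_zero _ h1, ?_⟩
    intro a ha
    exact (Commute.units_inv_left (h2 a ha))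

theorem root_mem (n : ℕ) (hn : n ≠ 0) (ζ : D) (hζK : ζ ∈ Subring.center D)
    (hζ : orderOf ζ = n) (x : D) (hx : x ^ n = 1) : ∃ k : ℕ, x = ζ ^ k := by
  set z : Subring.center D := ⟨ζ, hζK⟩ with hz
  have hzo : orderOf z = n := by
    rw [← hζ]
    exact (orderOf_injective (Subring.center D).subtype.toMonoidHom Subtype.val_injective z).symm
  have hprim : IsPrimitiveRoot z n := by rw [← hzo]; exact IsPrimitiveRoot.orderOf z
  have hfac := Polynomial.X_pow_sub_one_eq_prod (Nat.pos_of_ne_zero hn) hprim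
  have h0 : Polynomial.aeval x
      (∏ r ∈ Polynomial.nthRootsFinset n (1 : Subring.center D),
        (Polynomial.X - Polynomial.C r)) = 0 := by
    rw [← hfac]; simp [hx]
  have key : ∀ s : Finset (Subring.center D),
      Polynomial.aeval x (∏ r ∈ s, (Polynomial.X - Polynomial.C r)) = 0 → ∃ r ∈ s, x = (r : D) := by
    classical
    intro s
    induction s using Finset.induction_on with
    | empty => intro h; simp at h
    | insert r s hr ih =>
      intro h
      rw [Finset.prod_insert hr, map_mul] at h
      rcases mul_eq_zero.1 h with h | h
      · refine ⟨r, Finset.mem_insert_self _ _, ?_⟩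
        rw [map_sub, Polynomial.aeval_X, Polynomial.aeval_C] at h
        exact sub_eq_zero.1 h
      · obtain ⟨r', hr', h'⟩ := ih h
        exact ⟨r', Finset.mem_insert_of_mem hr', h'⟩
  obtain ⟨r, hr, rfl⟩ := key _ h0
  rw [Polynomial.mem_nthRootsFinset (Nat.pos_of_ne_zero hn)] at hr
  have : NeZero n := ⟨hn⟩
  obtain ⟨k, -, hk⟩ := hprim.eq_pow_of_pow_eq_one hr
  exact ⟨k, by rw [← hk]; rfl⟩

theorem H_abel [Finite G] [CharZero D]
    (𝒜 : G → AddSubgroup D) (hG : IsFaithfulGrading 𝒜)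
    (ζ : D) (hζK : ζ ∈ Subring.center D) (hζe : ζ ∈ 𝒜 1)
    (hζ : orderOf ζ = Monoid.exponent G)
    (H : Subgroup G)
    (hrep : ∀ h ∈ H, ∃ x : D, x ≠ 0 ∧ x ∈ 𝒜 h ∧ ∀ a ∈ 𝒜 1, x * a = a * x) (a b : H) :
    a * b = b * a := by
  classical
  have := Fintype.ofFinite G
  obtain ⟨π, h1, h2, h3, h4⟩ := exists_proj 𝒜 hG
  have hinv := inv_hom hG h1 h2 h3 h4
  set n := Monoid.exponent G with hn
  have hn0 : n ≠ 0 := Monoid.exponent_ne_zero_of_finite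
  let Γ := GammaGrp 𝒜 hG.one_mem hG.mul_mem hinv H
  let δ : Γ →* H := (MonoidHom.snd Dˣ H).comp Γ.subtype
  have hpow : ∀ k : ℕ, ζ ^ k ∈ 𝒜 1 := by
    intro k
    induction k with
    | zero => simpa using hG.one_mem
    | succ k ih => rw [pow_succ]; simpa using hG.mul_mem ih hζe
  have hneg1 : (-1 : D) ∈ 𝒜 1 := neg_mem hG.one_mem
  let ε : Γ := ⟨(-1, 1), by simpa using hneg1, by simp⟩
  have hval : ∀ u v : Γ, (u.1.1 : D) = v.1.1 → u = v := by
    rintro ⟨⟨u, g⟩, hu⟩ ⟨⟨v, h⟩, hv⟩ huv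
    have huv : u = v := Units.ext huv
    subst huv
    have : g = h := Subtype.ext (eq_deg h3 h4 u.ne_zero hu.1 hv.1)
    subst this
    rfl
  have hdeg : ∀ u : Γ, (u.1.1 : D) ∈ 𝒜 1 → δ u = 1 := fun u hu =>
    Subtype.ext (eq_deg h3 h4 u.1.1.ne_zero u.2.1 hu)
  have C : Cfg δ n ε := by
    refine ⟨?_, ?_, hn0, ?_, rfl, ?_, ?_, ?_, ?_, ?_⟩
    · intro z hz g
      apply hval
      have hz' : z.1.2 = 1 := hz
      have : (z.1.1 : D) ∈ 𝒜 1 := by have := z.2.1; rw [hz'] at this; exact this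
      exact (g.2.2 _ this).symm
    · intro h; apply Subtype.ext; simpa using Monoid.pow_exponent_eq_one (h : G)
    · intro g hg
      have hg' : ((g.1.1 : D)) ^ n = 1 := by
        have := congrArg (fun u : Γ => (u.1.1 : D)) hg
        simpa using this
      obtain ⟨k, hk⟩ := root_mem n hn0 ζ hζK hζ _ hg'
      apply hdeg; rw [hk]; exact hpow k
    · intro h
      have := congrArg (fun u : Γ => (u.1.1 : D)) h
      have h : (-1 : D) = 1 := by simpa [ε] using this
      norm_num at h
    · apply hval; simp [ε]
    · intro g hg
      have hg' : ((g.1.1 : D)) ^ 2 = 1 := by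
        have := congrArg (fun u : Γ => (u.1.1 : D)) hg
        simpa using this
      rcases sq_one_cases _ hg' with h | h
      · left; apply hval; simpa using h
      · right; apply hval; simpa [ε] using h
    · intro h3n i j hi hj hij di dj dij
      have hi' : (i.1.1 : D) ^ 2 = -1 := by
        have := congrArg (fun u : Γ => (u.1.1 : D)) hi
        simpa [ε] using this
      have hj' : (j.1.1 : D) ^ 2 = -1 := by
        have := congrArg (fun u : Γ => (u.1.1 : D)) hj
        simpa [ε] using this
      have hij' : (i.1.1 : D) * j.1.1 = -(j.1.1 * i.1.1) := by
        have := congrArg (fun u : Γ => (u.1.1 : D)) hij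
        simpa [ε] using this
      obtain ⟨m, hm⟩ := h3n
      have hm0 : m ≠ 0 := by rintro rfl; exact hn0 (by simpa using hm)
      set w := ζ ^ m with hw
      have hwK : w ∈ Subring.center D := Subring.pow_mem _ hζK m
      have hwc : ∀ a : D, w * a = a * w := fun a => (Subring.mem_center_iff.1 hwK a).symm
      have hw3 : w ^ 3 = 1 := by rw [hw, ← pow_mul, mul_comm, ← hm, ← hζ, pow_orderOf_eq_one]
      have hw1 : w ≠ 1 := by
        intro h
        have := orderOf_dvd_of_pow_eq_one h
        rw [hζ, hm] at this
        have := Nat.le_of_dvd (Nat.pos_of_ne_zero hm0) this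
        omega
      have hww : w ^ 2 + w + 1 = 0 := by
        have : (w - 1) * (w ^ 2 + w + 1) = 0 := by
          have : (w - 1) * (w ^ 2 + w + 1) = w ^ 3 - 1 := by noncomm_ring
          rw [this, hw3, sub_self]
        exact (mul_eq_zero.1 this).resolve_left (sub_ne_zero.2 hw1)
      have hU := q8_elt (i.1.1 : D) j.1.1 w hi' hj' hij' hwc hww
      have hwe : w ∈ 𝒜 1 := hpow m
      have hUe : (1 + (i.1.1 : D) + j.1.1 + i.1.1 * j.1.1) ∈ 𝒜 1 := by
        rcases hU with h | h
        · rw [h]; exact neg_mem (add_mem hwe hwe)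
        · rw [h]
          have : w ^ 2 ∈ 𝒜 1 := by rw [hw, ← pow_mul]; exact hpow _
          exact neg_mem (add_mem this this)
      have hdi : ((i.1.2 : H) : G) ≠ 1 := fun h => di (Subtype.ext h)
      have hdj : ((j.1.2 : H) : G) ≠ 1 := fun h => dj (Subtype.ext h)
      have hdij : ((i.1.2 : H) : G) ≠ j.1.2 := fun h => dij (Subtype.ext h)
      have key := h4 1 (i.1.2 : G) _ hUe hdi.symm
      rw [map_add, map_add, map_add, h4 1 _ _ hG.one_mem hdi.symm, h3 _ _ i.2.1,
        h4 _ _ _ j.2.1 hdij.symm, h4 _ _ _ (hG.mul_mem i.2.1 j.2.1) (by simpa using hdj)] at key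
      simp at key
    · rintro ⟨h, hh⟩
      obtain ⟨x, hx0, hx, hxa⟩ := hrep h hh
      exact ⟨⟨(Units.mk0 x hx0, ⟨h, hh⟩), hx, hxa⟩, rfl⟩
  exact C.abel a b

/-- Under the standing hypotheses, if the commutator pairing
`c : H × H → Lˣ`, `c(h,h') = x y x⁻¹ y⁻¹` (for any nonzero `x ∈ D_h`, `y ∈ D_{h'}`
commuting with every element of `D_e`), is nondegenerate — i.e. for every `h ≠ e` in `H`
there is `h' ∈ H` with `c(h,h') ≠ 1` — then the center `K` of `D` is contained in the
identity component `D_e`. -/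
theorem center_subset_De_of_nondegenerate
    [Finite G] [CharZero D]
    (𝒜 : G → AddSubgroup D) (hG : IsFaithfulGrading 𝒜)
    [Module.Finite ↥(Subring.center D) D]
    (ζ : D) (hζK : ζ ∈ Subring.center D) (hζe : ζ ∈ 𝒜 1)
    (hζ : orderOf ζ = Monoid.exponent G)
    (H : Subgroup G) (hHcar : (H : Set G) = Hset 𝒜) (hHn : H.Normal)
    (hrep : ∀ h ∈ H, ∃ x : D, x ≠ 0 ∧ x ∈ 𝒜 h ∧ ∀ a ∈ 𝒜 1, x * a = a * x)
    -- nondegeneracy of the commutator pairing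
    (hnd : ∀ h ∈ H, h ≠ 1 → ∃ h' ∈ H,
      ∀ x : D, x ∈ 𝒜 h → x ≠ 0 → (∀ a ∈ 𝒜 1, x * a = a * x) →
      ∀ y : D, y ∈ 𝒜 h' → y ≠ 0 → (∀ a ∈ 𝒜 1, y * a = a * y) →
      x * y * x⁻¹ * y⁻¹ ≠ 1) :
    (Subring.center D : Set D) ⊆ 𝒜 1 := by
  classical
  have hfin := Fintype.ofFinite G
  have habel := H_abel 𝒜 hG ζ hζK hζe hζ H hrep
  obtain ⟨π, h1, h2, h3, h4⟩ := exists_proj 𝒜 hG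
  have hinv := inv_hom hG h1 h2 h3 h4
  intro k hk
  have hkc : ∀ a, a * k = k * a := fun a => Subring.mem_center_iff.1 hk a
  have hz : ∀ g, g ≠ 1 → π g k = 0 := by
    intro g hg
    by_contra hne
    have hcomm : ∀ a ∈ 𝒜 1, π g k * a = a * π g k := by
      intro a ha
      have e1 := proj_mul_left hG h1 h2 h3 h4 a k 1 g ha
      have e2 := proj_mul_right hG h1 h2 h3 h4 a k 1 g ha
      rw [one_mul] at e1
      rw [mul_one] at e2
      rw [← e1, ← e2, hkc]
    have hgH : g ∈ H := by
      have : g ∈ (H : Set G) := by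
        rw [hHcar]
        intro x hx l hl
        have ha : (π g k)⁻¹ * x ∈ 𝒜 1 := by
          simpa using hG.mul_mem (hinv _ hne g (h1 g k)) hx
        have hxe : x = π g k * ((π g k)⁻¹ * x) := by
          rw [← mul_assoc, mul_inv_cancel₀ hne, one_mul]
        rw [hxe, mul_assoc, ← hl.2 _ ha, ← mul_assoc, hcomm l hl.1, mul_assoc]
      exact this
    obtain ⟨h', hh', hnd'⟩ := hnd g hgH hg
    obtain ⟨y, hy0, hy, hya⟩ := hrep h' hh'
    apply hnd' (π g k) (h1 g k) hne hcomm y hy hy0 hya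
    have e1 := proj_mul_left hG h1 h2 h3 h4 y k h' g hy
    have e2 := proj_mul_right hG h1 h2 h3 h4 y k h' g hy
    have hc : h' * g = g * h' := congrArg Subtype.val (habel ⟨h', hh'⟩ ⟨g, hgH⟩)
    rw [hc, hkc, e2] at e1
    rw [e1, mul_assoc y, mul_inv_cancel₀ hne, mul_one, mul_inv_cancel₀ hy0]
  have : k = π 1 k := by
    conv_lhs => rw [← h2 k]
    apply Finset.sum_eq_single 1
    · intro g _ hg; exact hz g hg
    · simp
  rw [this]
  exact h1 1 k
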